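/- arXiv:1203.0021 — 3 statements merged into one kernel-verified Lean document; each statement's English description precedes it below -/
import Mathlib

section
/- Assume 𝔍 is independent. Then the map χ ↦ {X ∈ 𝔍 : χ(1_X) = 1} is a bijection from the character space of D (the set of nonzero continuous algebra homomorphisms D → ℂ) onto the set of nonempty 𝔍-valued filters. -/
variable {𝔓 : Type*} [TopologicalSpace 𝔓] [DiscreteTopology 𝔓]

/-- The indicator function `1_X`, as an element of `ℓ^∞(𝔓)` (realized as the C*-algebra
of bounded continuous functions on the discrete space `𝔓`). -/
noncomputable def indFn (X : Set 𝔓) : BoundedContinuousFunction 𝔓 ℂ :=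
  BoundedContinuousFunction.ofNormedAddCommGroup (Set.indicator X fun _ => (1 : ℂ))
    continuous_of_discreteTopology 1
    (by
      intro x
      by_cases hx : x ∈ X <;> simp [Set.indicator, hx])

/-- `D`, the smallest norm-closed `*`-subalgebra of `ℓ^∞(𝔓)` containing
`{1_X : X ∈ 𝔍}`. -/
noncomputable def Dalg (J : Set (Set 𝔓)) :
    NonUnitalStarSubalgebra ℂ (BoundedContinuousFunction 𝔓 ℂ) :=
  (NonUnitalStarAlgebra.adjoin ℂ (indFn '' J)).topologicalClosure

lemma indFn_mem_Dalg {J : Set (Set 𝔓)} {X : Set 𝔓} (hX : X ∈ J) : indFn X ∈ Dalg J :=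
  NonUnitalStarSubalgebra.le_topologicalClosure _
    (NonUnitalStarAlgebra.subset_adjoin ℂ _ ⟨X, hX, rfl⟩)

/-- `1_X` as an element of `D`, for `X ∈ 𝔍`. -/
noncomputable def indEl (J : Set (Set 𝔓)) (X : Set 𝔓) (hX : X ∈ J) : Dalg J :=
  ⟨indFn X, indFn_mem_Dalg hX⟩

/-- A family of subsets (containing `∅` and closed under finite intersections) is
independent if whenever a member equals a finite union of members, it equals one of them. -/
def IsIndepFamily {α : Type*} (J : Set (Set α)) : Prop :=
  ∀ X ∈ J, ∀ n : ℕ, 0 < n → ∀ Xs : Fin n → Set α,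
    (∀ i, Xs i ∈ J) → X = ⋃ i, Xs i → ∃ i, X = Xs i

/-- A `J`-valued filter. -/
def IsFilterOn {α : Type*} (J : Set (Set α)) (F : Set (Set α)) : Prop :=
  F ⊆ J ∧ (∀ X₁ ∈ F, ∀ X₂ ∈ J, X₁ ⊆ X₂ → X₂ ∈ F) ∧
    (∀ X₁ ∈ F, ∀ X₂ ∈ F, X₁ ∩ X₂ ∈ F) ∧ ∅ ∉ F

open Filter Topology

lemma indFn_apply_of_mem {X : Set 𝔓} {p : 𝔓} (hp : p ∈ X) : indFn X p = 1 :=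
  Set.indicator_of_mem hp fun _ => (1 : ℂ)

lemma indFn_apply_of_notMem {X : Set 𝔓} {p : 𝔓} (hp : p ∉ X) : indFn X p = 0 :=
  Set.indicator_of_notMem hp fun _ => (1 : ℂ)

lemma indFn_mul (X Y : Set 𝔓) : indFn X * indFn Y = indFn (X ∩ Y) := by
  ext p
  by_cases hX : p ∈ X <;> by_cases hY : p ∈ Y <;>
    simp [indFn_apply_of_mem, indFn_apply_of_notMem, hX, hY]

lemma star_indFn (X : Set 𝔓) : star (indFn X) = indFn X := by
  ext p
  by_cases hX : p ∈ X <;> simp [indFn_apply_of_mem, indFn_apply_of_notMem, hX]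

lemma indEl_mul {J : Set (Set 𝔓)} {X Y : Set 𝔓} (hX : X ∈ J) (hY : Y ∈ J) (hXY : X ∩ Y ∈ J) :
    indEl J X hX * indEl J Y hY = indEl J (X ∩ Y) hXY :=
  Subtype.ext (indFn_mul X Y)

lemma indEl_empty {J : Set (Set 𝔓)} (h0 : (∅ : Set 𝔓) ∈ J) : indEl J ∅ h0 = 0 :=
  Subtype.ext (by ext p; exact indFn_apply_of_notMem (Set.notMem_empty p))

/-- Continuous multiplicative functionals on `Dalg J` are determined by their values on the
indicator functions of members of `J`. -/
lemma Dalg_functional_ext {J : Set (Set 𝔓)} (φ ψ : WeakDual ℂ (Dalg J))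
    (hφ : ∀ x y, φ (x * y) = φ x * φ y) (hψ : ∀ x y, ψ (x * y) = ψ x * ψ y)
    (h : ∀ X (hX : X ∈ J), φ (indEl J X hX) = ψ (indEl J X hX)) : φ = ψ := by
  have key : ∀ x ∈ NonUnitalStarAlgebra.adjoin ℂ (indFn '' J),
      ∃ hx : x ∈ Dalg J, φ ⟨x, hx⟩ = ψ ⟨x, hx⟩ ∧
        φ (star ⟨x, hx⟩) = ψ (star ⟨x, hx⟩) := by
    intro x hx
    induction hx using NonUnitalStarAlgebra.adjoin_induction with
    | mem x hx =>
      obtain ⟨X, hX, rfl⟩ := hx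
      have hs : star (indEl J X hX) = indEl J X hX := Subtype.ext (star_indFn X)
      refine ⟨indFn_mem_Dalg hX, h X hX, ?_⟩
      change φ (star (indEl J X hX)) = ψ (star (indEl J X hX))
      rw [hs, h X hX]
    | add x y _ _ ihx ihy =>
      obtain ⟨hx, hx₁, hx₂⟩ := ihx
      obtain ⟨hy, hy₁, hy₂⟩ := ihy
      refine ⟨add_mem hx hy, ?_⟩
      change φ (⟨x, hx⟩ + ⟨y, hy⟩) = ψ (⟨x, hx⟩ + ⟨y, hy⟩) ∧
        φ (star (⟨x, hx⟩ + ⟨y, hy⟩)) = ψ (star (⟨x, hx⟩ + ⟨y, hy⟩))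
      simp only [star_add, map_add, hx₁, hx₂, hy₁, hy₂, and_self]
    | zero =>
      refine ⟨zero_mem _, ?_⟩
      change φ 0 = ψ 0 ∧ φ (star 0) = ψ (star 0)
      simp only [star_zero, map_zero, and_self]
    | mul x y _ _ ihx ihy =>
      obtain ⟨hx, hx₁, hx₂⟩ := ihx
      obtain ⟨hy, hy₁, hy₂⟩ := ihy
      refine ⟨mul_mem hx hy, ?_⟩
      change φ (⟨x, hx⟩ * ⟨y, hy⟩) = ψ (⟨x, hx⟩ * ⟨y, hy⟩) ∧
        φ (star (⟨x, hx⟩ * ⟨y, hy⟩)) = ψ (star (⟨x, hx⟩ * ⟨y, hy⟩))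
      simp only [star_mul, hφ, hψ, hx₁, hx₂, hy₁, hy₂, and_self]
    | smul r x _ ih =>
      obtain ⟨hx, hx₁, hx₂⟩ := ih
      refine ⟨SMulMemClass.smul_mem r hx, ?_⟩
      change φ (r • ⟨x, hx⟩) = ψ (r • ⟨x, hx⟩) ∧
        φ (star (r • ⟨x, hx⟩)) = ψ (star (r • ⟨x, hx⟩))
      simp only [star_smul, map_smul, hx₁, hx₂, and_self]
    | star x _ ih =>
      obtain ⟨hx, hx₁, hx₂⟩ := ih
      refine ⟨star_mem hx, ?_⟩
      change φ (star ⟨x, hx⟩) = ψ (star ⟨x, hx⟩) ∧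
        φ (star (star ⟨x, hx⟩)) = ψ (star (star ⟨x, hx⟩))
      simp only [star_star, hx₁, hx₂, and_self]
  refine ContinuousLinearMap.ext fun ⟨x, hx⟩ => ?_
  obtain ⟨u, hu, hux⟩ := mem_closure_iff_seq_limit.mp
    (show x ∈ closure (NonUnitalStarAlgebra.adjoin ℂ (indFn '' J) : Set _) from hx)
  choose hD hD' using fun n => key (u n) (hu n)
  have hlim : Tendsto (fun n => (⟨u n, hD n⟩ : Dalg J)) atTop (𝓝 ⟨x, hx⟩) :=
    tendsto_subtype_rng.mpr hux
  refine tendsto_nhds_unique ((map_continuous φ).tendsto _ |>.comp hlim) ?_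
  exact ((map_continuous ψ).tendsto _ |>.comp hlim).congr fun n => (hD' n).1.symm

/-- The limit of a bounded function along an ultrafilter. -/
noncomputable def ultraLim {α : Type*} [TopologicalSpace α] (U : Ultrafilter α)
    (f : BoundedContinuousFunction α ℂ) : ℂ :=
  limUnder (U : Filter α) f

lemma tendsto_ultraLim {α : Type*} [TopologicalSpace α] (U : Ultrafilter α)
    (f : BoundedContinuousFunction α ℂ) :
    Tendsto f U (𝓝 (ultraLim U f)) := by
  obtain ⟨z, -, hz⟩ := (isCompact_closedBall (0 : ℂ) ‖f‖).ultrafilter_le_nhds (U.map f)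
    (le_principal_iff.mpr (Filter.mem_map.mpr (univ_mem' fun p => by
      simpa using f.norm_coe_le_norm p)))
  exact tendsto_nhds_limUnder ⟨z, hz⟩

/-- The limit along an ultrafilter as a continuous functional on `Dalg J`. -/
noncomputable def ultraLimDual (J : Set (Set 𝔓)) (U : Ultrafilter 𝔓) : WeakDual ℂ (Dalg J) :=
  LinearMap.mkContinuous
    { toFun := fun x : Dalg J => ultraLim U x
      map_add' := fun x y => tendsto_nhds_unique (tendsto_ultraLim U (x + y : Dalg J))
        ((tendsto_ultraLim U x).add (tendsto_ultraLim U y))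
      map_smul' := fun r x => tendsto_nhds_unique (tendsto_ultraLim U (r • x : Dalg J))
        ((tendsto_ultraLim U x).const_smul r) } 1
    fun x => by
      rw [one_mul]
      exact le_of_tendsto (tendsto_ultraLim U x).norm
        (Eventually.of_forall fun p => (x : BoundedContinuousFunction 𝔓 ℂ).norm_coe_le_norm p)

lemma ultraLimDual_mul (J : Set (Set 𝔓)) (U : Ultrafilter 𝔓) (x y : Dalg J) :
    ultraLimDual J U (x * y) = ultraLimDual J U x * ultraLimDual J U y :=
  tendsto_nhds_unique (tendsto_ultraLim U (x * y : Dalg J))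
    ((tendsto_ultraLim U x).mul (tendsto_ultraLim U y))

lemma ultraLimDual_indEl_of_mem {J : Set (Set 𝔓)} {U : Ultrafilter 𝔓} {X : Set 𝔓} (hX : X ∈ J)
    (hU : X ∈ U) : ultraLimDual J U (indEl J X hX) = 1 :=
  tendsto_nhds_unique (tendsto_ultraLim U (indFn X)) (tendsto_const_nhds.congr'
    (mem_of_superset (x := X) hU fun _ hp => (indFn_apply_of_mem hp).symm))

lemma ultraLimDual_indEl_of_compl_mem {J : Set (Set 𝔓)} {U : Ultrafilter 𝔓} {X : Set 𝔓}
    (hX : X ∈ J) (hU : Xᶜ ∈ U) : ultraLimDual J U (indEl J X hX) = 0 :=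
  tendsto_nhds_unique (tendsto_ultraLim U (indFn X)) (tendsto_const_nhds.congr'
    (mem_of_superset (x := Xᶜ) hU fun _ hp => (indFn_apply_of_notMem hp).symm))

/-- In an independent family, a member of a filter covered by finitely many members of the family
has one of these in the filter. -/
lemma IsFilterOn.exists_mem_of_subset_iUnion {α : Type*} {J F : Set (Set α)}
    (hcap : ∀ X ∈ J, ∀ Y ∈ J, X ∩ Y ∈ J) (hind : IsIndepFamily J) (hF : IsFilterOn J F)
    {X : Set α} (hX : X ∈ F) {n : ℕ} {Y : Fin n → Set α} (hY : ∀ i, Y i ∈ J)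
    (h : X ⊆ ⋃ i, Y i) : ∃ i, Y i ∈ F := by
  obtain ⟨hFJ, hup, -, hempty⟩ := hF
  rcases Nat.eq_zero_or_pos n with rfl | hn
  · rw [Set.iUnion_of_empty, Set.subset_empty_iff] at h
    exact absurd (h ▸ hX) hempty
  · obtain ⟨i, hi⟩ := hind X (hFJ hX) n hn (fun i => X ∩ Y i)
      (fun i => hcap _ (hFJ hX) _ (hY i))
      (by rw [← Set.inter_iUnion, Set.inter_eq_left.mpr h])
    exact ⟨i, hup X hX _ (hY i) (Set.inter_eq_left.mp hi.symm)⟩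

/-- A nonempty filter on an independent family is the trace of an ultrafilter. -/
lemma IsFilterOn.exists_ultrafilter {α : Type*} {J F : Set (Set α)}
    (hcap : ∀ X ∈ J, ∀ Y ∈ J, X ∩ Y ∈ J) (hind : IsIndepFamily J) (hF : IsFilterOn J F)
    (hne : F.Nonempty) :
    ∃ U : Ultrafilter α, (∀ X ∈ F, X ∈ U) ∧ ∀ Y ∈ J, Y ∉ F → Yᶜ ∈ U := by
  have hfin : ∀ s : Set (Set α), s.Finite → s ⊆ F ∪ compl '' (J \ F) →
      ∃ X ∈ F, ∃ (n : ℕ) (Y : Fin n → Set α), (∀ i, Y i ∈ J \ F) ∧ X ∩ (⋃ i, Y i)ᶜ ⊆ ⋂₀ s := by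
    intro s hs
    induction s, hs using Set.Finite.induction_on with
    | empty =>
      obtain ⟨X, hX⟩ := hne
      exact fun _ => ⟨X, hX, 0, Fin.elim0, fun i => i.elim0, by simp⟩
    | @insert a s _ _ ih =>
      intro h
      obtain ⟨ha, hs⟩ := Set.insert_subset_iff.mp h
      obtain ⟨X, hX, n, Y, hY, hsub⟩ := ih hs
      rw [Set.sInter_insert]
      rcases ha with ha | ⟨Z, hZ, rfl⟩
      · exact ⟨a ∩ X, hF.2.2.1 a ha X hX, n, Y, hY,
          fun p hp => ⟨hp.1.1, hsub ⟨hp.1.2, hp.2⟩⟩⟩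
      · refine ⟨X, hX, n + 1, Fin.cons Z Y, fun i => Fin.cases hZ hY i, fun p hp => ?_⟩
        have hp' : ∀ i, p ∉ (Fin.cons Z Y : Fin (n + 1) → Set α) i := by
          simpa only [Set.mem_compl_iff, Set.mem_iUnion, not_exists] using hp.2
        refine ⟨by simpa using hp' 0, hsub ⟨hp.1, ?_⟩⟩
        simpa only [Set.mem_compl_iff, Set.mem_iUnion, not_exists] using
          fun i : Fin n => by simpa using hp' i.succ
  have : (generate (F ∪ compl '' (J \ F))).NeBot := by
    refine generate_neBot_iff.mpr fun s hsub hs => ?_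
    obtain ⟨X, hX, n, Y, hY, h⟩ := hfin s hs hsub
    refine Set.Nonempty.mono h ?_
    rw [← Set.sdiff_eq, Set.sdiff_nonempty]
    intro hcov
    obtain ⟨i, hi⟩ := hF.exists_mem_of_subset_iUnion hcap hind hX (fun i => (hY i).1) hcov
    exact (hY i).2 hi
  have hle := Ultrafilter.of_le (generate (F ∪ compl '' (J \ F)))
  exact ⟨Ultrafilter.of (generate (F ∪ compl '' (J \ F))),
    fun X hX => hle (mem_generate_of_mem (Or.inl hX)),
    fun Y hY hYF => hle (mem_generate_of_mem (Or.inr ⟨Y, ⟨hY, hYF⟩, rfl⟩))⟩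

lemma functional_indEl_eq_zero_or_one {J : Set (Set 𝔓)} (φ : WeakDual ℂ (Dalg J))
    (hφ : ∀ x y, φ (x * y) = φ x * φ y) {X : Set 𝔓} (hX : X ∈ J) :
    φ (indEl J X hX) = 0 ∨ φ (indEl J X hX) = 1 := by
  refine IsIdempotentElem.iff_eq_zero_or_one.mp ?_
  rw [IsIdempotentElem, ← hφ]
  congr 1
  exact Subtype.ext ((indFn_mul X X).trans (by rw [Set.inter_self]; rfl))

/-- If `𝔍` is independent, then `χ ↦ {X ∈ 𝔍 : χ(1_X) = 1}` is a bijection from the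
character space of `D` onto the set of nonempty `𝔍`-valued filters. -/
theorem stmt_4 {J : Set (Set 𝔓)} (h0 : (∅ : Set 𝔓) ∈ J)
    (hcap : ∀ X ∈ J, ∀ Y ∈ J, X ∩ Y ∈ J) (hind : IsIndepFamily J) :
    Set.BijOn
      (fun χ : WeakDual.characterSpace ℂ (Dalg J) =>
        {X : Set 𝔓 | ∃ hX : X ∈ J, (χ : WeakDual ℂ (Dalg J)) (indEl J X hX) = 1})
      Set.univ {F : Set (Set 𝔓) | IsFilterOn J F ∧ F.Nonempty} := by
  refine ⟨?_, ?_, ?_⟩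
  · rintro ⟨φ, hφ0, hφ⟩ -
    refine ⟨⟨fun X hX => hX.1, ?_, ?_, ?_⟩, ?_⟩
    · rintro X ⟨hX, hX1⟩ Y hY hXY
      refine ⟨hY, ?_⟩
      have h := hφ (indEl J X hX) (indEl J Y hY)
      simp only [indEl_mul hX hY (hcap X hX Y hY), Set.inter_eq_left.mpr hXY] at h
      change φ (indEl J X hX) = 1 at hX1
      rw [hX1, one_mul] at h
      exact h.symm
    · rintro X ⟨hX, hX1⟩ Y ⟨hY, hY1⟩
      refine ⟨hcap X hX Y hY, ?_⟩
      change φ (indEl J X hX) = 1 at hX1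
      change φ (indEl J Y hY) = 1 at hY1
      change φ (indEl J (X ∩ Y) (hcap X hX Y hY)) = 1
      rw [← indEl_mul hX hY, hφ, hX1, hY1, one_mul]
    · rintro ⟨h, h1⟩
      rw [indEl_empty, map_zero] at h1
      exact zero_ne_one h1
    · by_contra hne
      refine hφ0 (Dalg_functional_ext φ 0 hφ (fun _ _ => (mul_zero (0 : ℂ)).symm) fun X hX => ?_)
      exact (functional_indEl_eq_zero_or_one φ hφ hX).resolve_right fun h => hne ⟨X, hX, h⟩
  · rintro ⟨φ, hφ0, hφ⟩ - ⟨ψ, hψ0, hψ⟩ - h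
    refine Subtype.ext (Dalg_functional_ext φ ψ hφ hψ fun X hX => ?_)
    have hiff : φ (indEl J X hX) = 1 ↔ ψ (indEl J X hX) = 1 := by
      have := Set.ext_iff.mp h X
      exact ⟨fun h1 => (this.mp ⟨hX, h1⟩).2, fun h1 => (this.mpr ⟨hX, h1⟩).2⟩
    rcases functional_indEl_eq_zero_or_one φ hφ hX with h1 | h1
    · rcases functional_indEl_eq_zero_or_one ψ hψ hX with h2 | h2
      · rw [h1, h2]
      · rw [hiff.mpr h2, h2]
    · rw [h1, hiff.mp h1]
  · rintro F ⟨hF, hne⟩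
    obtain ⟨U, hU, hU'⟩ := hF.exists_ultrafilter hcap hind hne
    have hne0 : ultraLimDual J U ≠ 0 := by
      obtain ⟨X, hX⟩ := hne
      intro h
      have h1 := ultraLimDual_indEl_of_mem (hF.1 hX) (hU X hX)
      rw [h] at h1
      exact zero_ne_one h1
    refine ⟨⟨ultraLimDual J U, hne0, ultraLimDual_mul J U⟩, Set.mem_univ _, ?_⟩
    ext X
    refine ⟨fun ⟨hX, h1⟩ => ?_, fun hX => ⟨hF.1 hX, ultraLimDual_indEl_of_mem _ (hU X hX)⟩⟩
    by_contra hXF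
    exact zero_ne_one ((ultraLimDual_indEl_of_compl_mem hX (hU' X hX hXF)).symm.trans h1)
end

section
/- For every p ∈ P: (a) pℱ ∈ Σ for every ℱ ∈ Σ; (b) pΣ is a clopen subset of Σ; (c) the map Σ → pΣ, ℱ ↦ pℱ, is a homeomorphism with inverse 𝒢 ↦ p⁻¹𝒢. -/
variable {G : Type*} [Group G]

/-- Left translate `g·X = {gx : x ∈ X}`. -/
def lmul (g : G) (X : Set G) : Set G := (g * ·) '' X

/-- `p⁻¹X = {y ∈ P : py ∈ X}`. -/
def presub (P : Submonoid G) (p : G) (X : Set G) : Set G := {y : G | y ∈ P ∧ p * y ∈ X}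

/-- The constructible right ideals of `P`: the smallest family of subsets of `P`
containing `∅` and `P` and closed under `X ↦ pX` and `X ↦ p⁻¹X` for `p ∈ P`. -/
inductive IsConstructible (P : Submonoid G) : Set G → Prop
  | empty : IsConstructible P ∅
  | base : IsConstructible P (P : Set G)
  | mul {p : G} (hp : p ∈ P) {X : Set G} (hX : IsConstructible P X) : IsConstructible P (lmul p X)
  | pre {p : G} (hp : p ∈ P) {X : Set G} (hX : IsConstructible P X) :
      IsConstructible P (presub P p X)

/-- `𝒥_P^G`: the smallest family of subsets of `G` containing `𝒥`, closed under left
translations by group elements and under finite intersections. -/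
inductive IsConstructibleG (P : Submonoid G) : Set G → Prop
  | base {X : Set G} (hX : IsConstructible P X) : IsConstructibleG P X
  | translate (g : G) {Y : Set G} (hY : IsConstructibleG P Y) : IsConstructibleG P (lmul g Y)
  | inter {Y₁ Y₂ : Set G} (h1 : IsConstructibleG P Y₁) (h2 : IsConstructibleG P Y₂) :
      IsConstructibleG P (Y₁ ∩ Y₂)

/-- The Toeplitz condition for `P ⊆ G` (set-theoretic form): for every `g ∈ G` with
`{x ∈ P : gx ∈ P} ≠ ∅` there are `p₁, q₁, …, pₙ, qₙ ∈ P` (`n ≥ 1`) with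
`g = p₁⁻¹q₁⋯pₙ⁻¹qₙ` and `{x ∈ P : gx ∈ P} = qₙ⁻¹(pₙ(⋯(q₁⁻¹(p₁P))⋯))`. -/
def IsToeplitz (P : Submonoid G) : Prop :=
  ∀ g : G, {x : G | x ∈ P ∧ g * x ∈ P}.Nonempty →
    ∃ l : List (G × G), l ≠ [] ∧ (∀ pq ∈ l, pq.1 ∈ P ∧ pq.2 ∈ P) ∧
      g = (l.map fun pq => pq.1⁻¹ * pq.2).prod ∧
      {x : G | x ∈ P ∧ g * x ∈ P} =
        l.foldl (fun S pq => presub P pq.2 (lmul pq.1 S)) (P : Set G)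

open Classical in
/-- Indicator function of a family of sets, with values in the discrete space `Bool`;
this realizes a family as a point of the product space `{0,1}^(Set α)`. -/
noncomputable def chiF {α : Type*} (F : Set (Set α)) : Set α → Bool :=
  fun X => if X ∈ F then true else false

/-- `Σ`, the space of nonempty `𝒥`-valued filters, topologized as a subspace of
`{0,1}^𝒥` via indicator functions. -/
def SigmaT (P : Submonoid G) : Type _ :=
  {F : Set (Set G) // IsFilterOn {X : Set G | IsConstructible P X} F ∧ F.Nonempty}

noncomputable instance (P : Submonoid G) : TopologicalSpace (SigmaT P) :=
  TopologicalSpace.induced (fun F : SigmaT P => chiF F.1) inferInstance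

/-- `pℱ = {X ∈ 𝒥 : p⁻¹X ∈ ℱ}`. -/
def fwdF (P : Submonoid G) (p : G) (F : Set (Set G)) : Set (Set G) :=
  {X : Set G | IsConstructible P X ∧ presub P p X ∈ F}

/-- `p⁻¹𝒢 = {X ∈ 𝒥 : pX ∈ 𝒢}`. -/
def bwdF (P : Submonoid G) (p : G) (F : Set (Set G)) : Set (Set G) :=
  {X : Set G | IsConstructible P X ∧ lmul p X ∈ F}

theorem subset_of_isConstructible {P : Submonoid G} {X : Set G} (hX : IsConstructible P X) :
    X ⊆ P := by
  induction hX with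
  | empty => exact Set.empty_subset _
  | base => exact subset_rfl
  | mul hp _ ih =>
    rintro _ ⟨x, hx, rfl⟩
    exact P.mul_mem hp (ih hx)
  | pre _ _ _ => exact fun _ hx => hx.1

theorem mul_mem_lmul_iff {g x : G} {X : Set G} : g * x ∈ lmul g X ↔ x ∈ X := by
  simp [lmul]

theorem lmul_empty (g : G) : lmul g ∅ = ∅ := Set.image_empty _

theorem lmul_mono (g : G) {X Y : Set G} (h : X ⊆ Y) : lmul g X ⊆ lmul g Y :=
  Set.image_mono h

theorem lmul_inter (g : G) (X Y : Set G) : lmul g (X ∩ Y) = lmul g X ∩ lmul g Y :=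
  Set.image_inter (mul_right_injective g)

theorem presub_empty (P : Submonoid G) (p : G) : presub P p ∅ = ∅ := by
  simp [presub]

theorem presub_mono (P : Submonoid G) (p : G) {X Y : Set G} (h : X ⊆ Y) :
    presub P p X ⊆ presub P p Y :=
  fun _ hx => ⟨hx.1, h hx.2⟩

theorem presub_inter (P : Submonoid G) (p : G) (X Y : Set G) :
    presub P p (X ∩ Y) = presub P p X ∩ presub P p Y := by
  ext x
  simp only [presub, Set.mem_inter_iff, Set.mem_ofPred_eq]
  tauto

theorem presub_self {P : Submonoid G} {p : G} (hp : p ∈ P) : presub P p (P : Set G) = P := by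
  ext x
  exact ⟨fun hx => hx.1, fun hx => ⟨hx, P.mul_mem hp hx⟩⟩

theorem presub_lmul {P : Submonoid G} (p : G) {X : Set G} (hX : X ⊆ P) :
    presub P p (lmul p X) = X := by
  ext x
  simp only [presub, Set.mem_ofPred_eq, mul_mem_lmul_iff]
  exact ⟨fun hx => hx.2, fun hx => ⟨hX hx, hx⟩⟩

theorem lmul_inter_presub {P : Submonoid G} (p : G) {X : Set G} (hX : X ⊆ P) (Y : Set G) :
    lmul p (X ∩ presub P p Y) = lmul p X ∩ Y := by
  ext x
  constructor
  · rintro ⟨y, hy, rfl⟩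
    exact ⟨⟨y, hy.1, rfl⟩, hy.2.2⟩
  · rintro ⟨⟨y, hy, rfl⟩, hx⟩
    exact ⟨y, ⟨hy, hX hy, hx⟩, rfl⟩

theorem lmul_presub (P : Submonoid G) (p : G) (X : Set G) :
    lmul p (presub P p X) = lmul p (P : Set G) ∩ X := by
  rw [← lmul_inter_presub p subset_rfl, Set.inter_eq_right.2 fun _ hx => hx.1]

theorem isConstructible_inter {P : Submonoid G} {X Y : Set G} (hX : IsConstructible P X)
    (hY : IsConstructible P Y) : IsConstructible P (X ∩ Y) := by
  induction hX generalizing Y with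
  | empty => simpa using IsConstructible.empty
  | base => rwa [Set.inter_eq_right.2 (subset_of_isConstructible hY)]
  | @mul p hp X hX ih =>
    rw [← lmul_inter_presub p (subset_of_isConstructible hX)]
    exact .mul hp (ih (.pre hp hY))
  | @pre p hp X hX ih =>
    rw [← presub_lmul p (subset_of_isConstructible hY), ← presub_inter]
    exact .pre hp (ih (.mul hp hY))

theorem coe_mem_of_isFilterOn {P : Submonoid G} {F : Set (Set G)}
    (hF : IsFilterOn {X : Set G | IsConstructible P X} F) (hne : F.Nonempty) :
    (P : Set G) ∈ F :=
  let ⟨_, hX⟩ := hne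
  hF.2.1 _ hX _ .base (subset_of_isConstructible (hF.1 hX))

theorem isFilterOn_fwdF {P : Submonoid G} {p : G} (hp : p ∈ P) {F : Set (Set G)}
    (hF : IsFilterOn {X : Set G | IsConstructible P X} F) :
    IsFilterOn {X : Set G | IsConstructible P X} (fwdF P p F) := by
  refine ⟨fun _ hX => hX.1, fun X hX Y hY h => ⟨hY, ?_⟩, fun X hX Y hY => ⟨?_, ?_⟩, fun h => ?_⟩
  · exact hF.2.1 _ hX.2 _ (.pre hp hY) (presub_mono P p h)
  · exact isConstructible_inter hX.1 hY.1
  · rw [presub_inter]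
    exact hF.2.2.1 _ hX.2 _ hY.2
  · exact hF.2.2.2 (presub_empty P p ▸ h.2)

theorem lmul_coe_mem_fwdF {P : Submonoid G} {p : G} (hp : p ∈ P) {F : Set (Set G)}
    (hF : IsFilterOn {X : Set G | IsConstructible P X} F) (hne : F.Nonempty) :
    lmul p (P : Set G) ∈ fwdF P p F :=
  ⟨.mul hp .base, (presub_lmul p subset_rfl).symm ▸ coe_mem_of_isFilterOn hF hne⟩

theorem isFilterOn_bwdF {P : Submonoid G} {p : G} (hp : p ∈ P) {F : Set (Set G)}
    (hF : IsFilterOn {X : Set G | IsConstructible P X} F) :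
    IsFilterOn {X : Set G | IsConstructible P X} (bwdF P p F) := by
  refine ⟨fun _ hX => hX.1, fun X hX Y hY h => ⟨hY, ?_⟩, fun X hX Y hY => ⟨?_, ?_⟩, fun h => ?_⟩
  · exact hF.2.1 _ hX.2 _ (.mul hp hY) (lmul_mono p h)
  · exact isConstructible_inter hX.1 hY.1
  · rw [lmul_inter]
    exact hF.2.2.1 _ hX.2 _ hY.2
  · exact hF.2.2.2 (lmul_empty p ▸ h.2)

theorem bwdF_fwdF {P : Submonoid G} {p : G} (hp : p ∈ P) {F : Set (Set G)}
    (hF : IsFilterOn {X : Set G | IsConstructible P X} F) :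
    bwdF P p (fwdF P p F) = F := by
  ext X
  constructor
  · rintro ⟨hX, -, h⟩
    rwa [presub_lmul p (subset_of_isConstructible hX)] at h
  · intro h
    have hX : IsConstructible P X := hF.1 h
    exact ⟨hX, .mul hp hX, by rwa [presub_lmul p (subset_of_isConstructible hX)]⟩

theorem fwdF_bwdF {P : Submonoid G} {p : G} (hp : p ∈ P) {F : Set (Set G)}
    (hF : IsFilterOn {X : Set G | IsConstructible P X} F) (hpF : lmul p (P : Set G) ∈ F) :
    fwdF P p (bwdF P p F) = F := by
  ext X
  constructor
  · rintro ⟨hX, -, h⟩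
    rw [lmul_presub] at h
    exact hF.2.1 _ h _ hX Set.inter_subset_right
  · intro h
    have hX : IsConstructible P X := hF.1 h
    refine ⟨hX, .pre hp hX, ?_⟩
    rw [lmul_presub]
    exact hF.2.2.1 _ hpF _ h

theorem continuous_chiF_apply (P : Submonoid G) (X : Set G) :
    Continuous fun F : SigmaT P => chiF F.1 X :=
  (continuous_apply X).comp
    (continuous_induced_dom : Continuous fun F : SigmaT P => chiF F.1)

theorem isClopen_setOf_mem (P : Submonoid G) (X : Set G) :
    IsClopen {F : SigmaT P | X ∈ F.1} := by
  convert (isClopen_discrete {true}).preimage (continuous_chiF_apply P X) using 1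
  ext F
  simp [chiF]

theorem continuous_of_mem_iff {A : Type*} [TopologicalSpace A] {P : Submonoid G}
    {f i : A → SigmaT P} (hi : Continuous i) (T : Set G → Set G)
    (h : ∀ a X, X ∈ (f a).1 ↔ IsConstructible P X ∧ T X ∈ (i a).1) : Continuous f := by
  refine continuous_induced_rng.2 (continuous_pi fun X => ?_)
  by_cases hX : IsConstructible P X
  · convert (continuous_chiF_apply P (T X)).comp hi using 2 with a
    simp [chiF, h, hX]
  · convert (continuous_const : Continuous fun _ : A => false) using 2 with a
    simp [chiF, h, hX]

/-- For `p ∈ P`: (a) `pℱ ∈ Σ` for every `ℱ ∈ Σ`; (b) `pΣ = {ℱ ∈ Σ : pP ∈ ℱ}` is clopen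
in `Σ`; (c) `ℱ ↦ pℱ` is a homeomorphism from `Σ` onto `pΣ` with inverse `𝒢 ↦ p⁻¹𝒢`. -/
theorem stmt_9 (P : Submonoid G) (p : G) (hp : p ∈ P) :
    (∀ F : Set (Set G), IsFilterOn {X : Set G | IsConstructible P X} F → F.Nonempty →
        IsFilterOn {X : Set G | IsConstructible P X} (fwdF P p F) ∧ (fwdF P p F).Nonempty) ∧
      IsClopen {F : SigmaT P | lmul p (P : Set G) ∈ F.1} ∧
      ∃ h : SigmaT P ≃ₜ {F : SigmaT P // lmul p (P : Set G) ∈ F.1},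
        (∀ F : SigmaT P, (h F).1.1 = fwdF P p F.1) ∧
        ∀ Gf : {F : SigmaT P // lmul p (P : Set G) ∈ F.1},
          (h.symm Gf).1 = bwdF P p Gf.1.1 := by
  refine ⟨fun F hF hne => ⟨isFilterOn_fwdF hp hF, _, lmul_coe_mem_fwdF hp hF hne⟩,
    isClopen_setOf_mem P _, ?_⟩
  let h : SigmaT P ≃ₜ {F : SigmaT P // lmul p (P : Set G) ∈ F.1} :=
    { toFun := fun F => ⟨⟨fwdF P p F.1, isFilterOn_fwdF hp F.2.1, _,
        lmul_coe_mem_fwdF hp F.2.1 F.2.2⟩, lmul_coe_mem_fwdF hp F.2.1 F.2.2⟩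
      invFun := fun F => ⟨bwdF P p F.1.1, isFilterOn_bwdF hp F.1.2.1, (P : Set G), .base, F.2⟩
      left_inv := fun F => Subtype.ext (bwdF_fwdF hp F.2.1)
      right_inv := fun F => Subtype.ext (Subtype.ext (fwdF_bwdF hp F.1.2.1 F.2))
      continuous_toFun := Continuous.subtype_mk
        (continuous_of_mem_iff continuous_id (presub P p) fun _ _ => Iff.rfl) _
      continuous_invFun :=
        continuous_of_mem_iff continuous_subtype_val (lmul p) fun _ _ => Iff.rfl }
  exact ⟨h, fun _ => rfl, fun _ => rfl⟩
end

section
/- The set G₀ := {g ∈ G : for every nonempty X ∈ 𝒥, (g·P) ∩ X ≠ ∅ and (g⁻¹·P) ∩ X ≠ ∅} is a subgroup of G. -/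
variable {G : Type*} [Group G]

/-- Constructible right ideals of `P` are contained in `P`. -/
theorem IsConstructible.subset {P : Submonoid G} {X : Set G} (hX : IsConstructible P X) :
    X ⊆ (P : Set G) := by
  induction hX with
  | empty => exact Set.empty_subset _
  | base => exact subset_rfl
  | mul hp _ ih =>
    rintro _ ⟨x, hx, rfl⟩
    exact P.mul_mem hp (ih hx)
  | pre hp _ ih => exact fun y hy => hy.1

/-- Constructible right ideals of `P` are closed under right multiplication by `P`. -/
theorem IsConstructible.mul_mem {P : Submonoid G} {X : Set G} (hX : IsConstructible P X)
    {x r : G} (hx : x ∈ X) (hr : r ∈ P) : x * r ∈ X := by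
  induction hX generalizing x with
  | empty => exact hx.elim
  | base => exact P.mul_mem hx hr
  | mul hp _ ih =>
    obtain ⟨y, hy, rfl⟩ := hx
    exact ⟨y * r, ih hy, (mul_assoc _ _ _).symm⟩
  | pre hp _ ih => exact ⟨P.mul_mem hx.1 hr, by simpa only [mul_assoc] using ih hx.2⟩

/-- If `gP` and `hP` meet every nonempty constructible right ideal, then so does `ghP`. -/
theorem lmul_mul_inter_nonempty {P : Submonoid G} {g h : G}
    (hg : ∀ X : Set G, IsConstructible P X → X.Nonempty → (lmul g (P : Set G) ∩ X).Nonempty)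
    (hh : ∀ X : Set G, IsConstructible P X → X.Nonempty → (lmul h (P : Set G) ∩ X).Nonempty)
    {X : Set G} (hX : IsConstructible P X) (hne : X.Nonempty) :
    (lmul (g * h) (P : Set G) ∩ X).Nonempty := by
  obtain ⟨_, ⟨p, hp, rfl⟩, hgp⟩ := hg X hX hne
  obtain ⟨_, ⟨q, hq, rfl⟩, r, hr, hpr⟩ :=
    hh (lmul p (P : Set G)) (.mul hp .base) ⟨p * 1, 1, P.one_mem, rfl⟩
  dsimp only at hpr hgp
  refine ⟨g * h * q, ⟨q, hq, rfl⟩, ?_⟩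
  rw [mul_assoc, ← hpr, ← mul_assoc]
  exact hX.mul_mem hgp hr

/-- `G₀ = {g ∈ G : (g·P) ∩ X ≠ ∅ and (g⁻¹·P) ∩ X ≠ ∅ for all nonempty X ∈ 𝒥}` is a
subgroup of `G`. -/
theorem stmt_13 (P : Submonoid G) :
    ∃ H : Subgroup G, (H : Set G) =
      {g : G | ∀ X : Set G, IsConstructible P X → X.Nonempty →
        (lmul g (P : Set G) ∩ X).Nonempty ∧ (lmul g⁻¹ (P : Set G) ∩ X).Nonempty} := by
  refine ⟨{ carrier := _, mul_mem' := ?_, one_mem' := ?_, inv_mem' := ?_ }, rfl⟩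
  · intro g h hg hh X hX hne
    refine ⟨lmul_mul_inter_nonempty (fun Y hY hn => (hg Y hY hn).1)
      (fun Y hY hn => (hh Y hY hn).1) hX hne, ?_⟩
    rw [mul_inv_rev]
    exact lmul_mul_inter_nonempty (fun Y hY hn => (hh Y hY hn).2)
      (fun Y hY hn => (hg Y hY hn).2) hX hne
  · rintro X hX ⟨x, hx⟩
    have h : (lmul 1 (P : Set G) ∩ X).Nonempty := ⟨x, ⟨x, hX.subset hx, one_mul x⟩, hx⟩
    exact ⟨h, by rwa [inv_one]⟩
  · intro g hg X hX hne
    rw [inv_inv]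
    exact (hg X hX hne).symm
end
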